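/- Let p, q ∈ ℝ and let A₃ be the 3×3 octonionic matrix !![p, q i, −q(j − iℓ − jℓ); −q i, p, q(1 + k + ℓ); q(j − iℓ − jℓ), q(1 − k − ℓ), p]. Then A₃ is Hermitian, and the vector v = (j, ℓ, 0)ᵀ ∈ 𝕆³ satisfies the right eigenvalue equation A₃ v = v λ with the non-real eigenvalue λ = p − q (kℓ). -/

import Mathlib

noncomputable section

/-- The octonions, as the Cayley–Dickson double of the quaternions. -/
def Octonion : Type := Quaternion ℝ × Quaternion ℝ

namespace Octonion

instance : AddCommGroup Octonion :=
  inferInstanceAs (AddCommGroup (Quaternion ℝ × Quaternion ℝ))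

instance : Module ℝ Octonion :=
  inferInstanceAs (Module ℝ (Quaternion ℝ × Quaternion ℝ))

/-- Cayley–Dickson multiplication: (a,b)·(c,d) = (a c − conj(d) b, d a + b conj(c)). -/
instance : Mul Octonion :=
  ⟨fun x y => (x.1 * y.1 - star y.2 * x.2, y.2 * x.1 + x.2 * star y.1)⟩

instance : One Octonion := ⟨((1 : Quaternion ℝ), 0)⟩

/-- Octonionic conjugation: conj (a,b) = (conj a, −b). -/
def conj (x : Octonion) : Octonion := (star x.1, -x.2)

/-- Real part of an octonion. -/
def re (x : Octonion) : ℝ := x.1.re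

/-- Imaginary part of an octonion. -/
def im (x : Octonion) : Octonion := x - re x • 1

/-- Embedding of the reals into the octonions. -/
def ofReal (r : ℝ) : Octonion := (((r : ℝ) : Quaternion ℝ), 0)

/-- The squared norm |w|² (the real scalar such that w · conj w = |w|² · 1). -/
def normSq (x : Octonion) : ℝ := Quaternion.normSq x.1 + Quaternion.normSq x.2

/-- The imaginary unit i. -/
def i : Octonion := ((⟨0, 1, 0, 0⟩ : Quaternion ℝ), 0)

/-- The imaginary unit j. -/
def j : Octonion := ((⟨0, 0, 1, 0⟩ : Quaternion ℝ), 0)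

/-- The imaginary unit k. -/
def k : Octonion := ((⟨0, 0, 0, 1⟩ : Quaternion ℝ), 0)

/-- The imaginary unit ℓ. -/
def l : Octonion := ((0 : Quaternion ℝ), (1 : Quaternion ℝ))

/-- The associator [x,y,z] = (xy)z − x(yz). -/
def assoc (x y z : Octonion) : Octonion := x * y * z - x * (y * z)

/-- A Jordan matrix: a 3×3 Hermitian matrix over the octonions. -/
def IsHermitian (A : Matrix (Fin 3) (Fin 3) Octonion) : Prop :=
  ∀ p q : Fin 3, conj (A q p) = A p q

/-- The right eigenvalue equation `A v = v λ`, componentwise. -/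
def Eig (A : Matrix (Fin 3) (Fin 3) Octonion) (v : Fin 3 → Octonion) (lam : Octonion) : Prop :=
  ∀ p : Fin 3, A p 0 * v 0 + A p 1 * v 1 + A p 2 * v 2 = v p * lam

end Octonion

namespace Octonion

@[ext]
theorem ext {x y : Octonion} (h₁ : x.1 = y.1) (h₂ : x.2 = y.2) : x = y :=
  Prod.ext h₁ h₂

@[simp] theorem fst_zero : (0 : Octonion).1 = 0 := rfl
@[simp] theorem snd_zero : (0 : Octonion).2 = 0 := rfl
@[simp] theorem fst_one : (1 : Octonion).1 = 1 := rfl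
@[simp] theorem snd_one : (1 : Octonion).2 = 0 := rfl
@[simp] theorem fst_add (x y : Octonion) : (x + y).1 = x.1 + y.1 := rfl
@[simp] theorem snd_add (x y : Octonion) : (x + y).2 = x.2 + y.2 := rfl
@[simp] theorem fst_sub (x y : Octonion) : (x - y).1 = x.1 - y.1 := rfl
@[simp] theorem snd_sub (x y : Octonion) : (x - y).2 = x.2 - y.2 := rfl
@[simp] theorem fst_neg (x : Octonion) : (-x).1 = -x.1 := rfl
@[simp] theorem snd_neg (x : Octonion) : (-x).2 = -x.2 := rfl
@[simp] theorem fst_smul (r : ℝ) (x : Octonion) : (r • x).1 = r • x.1 := rfl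
@[simp] theorem snd_smul (r : ℝ) (x : Octonion) : (r • x).2 = r • x.2 := rfl
@[simp] theorem fst_mul (x y : Octonion) : (x * y).1 = x.1 * y.1 - star y.2 * x.2 := rfl
@[simp] theorem snd_mul (x y : Octonion) : (x * y).2 = y.2 * x.1 + x.2 * star y.1 := rfl
@[simp] theorem fst_conj (x : Octonion) : (conj x).1 = star x.1 := rfl
@[simp] theorem snd_conj (x : Octonion) : (conj x).2 = -x.2 := rfl
@[simp] theorem fst_ofReal (r : ℝ) : (ofReal r).1 = (r : Quaternion ℝ) := rfl
@[simp] theorem snd_ofReal (r : ℝ) : (ofReal r).2 = 0 := rfl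
@[simp] theorem coords_fst_i : i.1.re = 0 ∧ i.1.imI = 1 ∧ i.1.imJ = 0 ∧ i.1.imK = 0 :=
  ⟨rfl, rfl, rfl, rfl⟩
@[simp] theorem snd_i : i.2 = 0 := rfl
@[simp] theorem coords_fst_j : j.1.re = 0 ∧ j.1.imI = 0 ∧ j.1.imJ = 1 ∧ j.1.imK = 0 :=
  ⟨rfl, rfl, rfl, rfl⟩
@[simp] theorem snd_j : j.2 = 0 := rfl
@[simp] theorem coords_fst_k : k.1.re = 0 ∧ k.1.imI = 0 ∧ k.1.imJ = 0 ∧ k.1.imK = 1 :=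
  ⟨rfl, rfl, rfl, rfl⟩
@[simp] theorem snd_k : k.2 = 0 := rfl
@[simp] theorem fst_l : l.1 = 0 := rfl
@[simp] theorem snd_l : l.2 = 1 := rfl

end Octonion

open Octonion in
/-- The matrix `A₃ = !![p, qi, −q(j − iℓ − jℓ); −qi, p, q(1 + k + ℓ);
q(j − iℓ − jℓ), q(1 − k − ℓ), p]` is Hermitian and admits `v = (j, ℓ, 0)ᵀ` as an
eigenvector with the non-real eigenvalue `p − q kℓ`. -/
theorem example_three (p q : ℝ) :
    IsHermitian !![ofReal p, q • i, -(q • (j - i * l - j * l));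
      -(q • i), ofReal p, q • ((1 : Octonion) + k + l);
      q • (j - i * l - j * l), q • ((1 : Octonion) - k - l), ofReal p] ∧
    Eig !![ofReal p, q • i, -(q • (j - i * l - j * l));
      -(q • i), ofReal p, q • ((1 : Octonion) + k + l);
      q • (j - i * l - j * l), q • ((1 : Octonion) - k - l), ofReal p]
      ![j, l, 0]
      (ofReal p - q • (k * l)) := by
  constructor
  · intro a b
    fin_cases a <;> fin_cases b <;> ext <;> simp [Quaternion.imK_one, sub_eq_add_neg]
  · intro a
    fin_cases a <;> ext <;>
      simp [Quaternion.re_zero, Quaternion.imI_zero, Quaternion.imJ_zero, Quaternion.imK_zero,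
        Quaternion.re_one, Quaternion.imI_one, Quaternion.imJ_one, Quaternion.imK_one]
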